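/- There exists a universal constant μ > 0 with the following property: for any a < b and any centered Gaussian process {Z_t}_{t ∈ [a,b]} with continuously differentiable sample paths t ↦ Z_t (with derivative Z'_t having finite second moments), if sup_{t ∈ [a,b]} E[Z_t²] > 0 and 2 (b − a)² · sup_{t ∈ [a,b]} E[(Z'_t)²] ≤ sup_{t ∈ [a,b]} E[Z_t²], then P( sup_{t ∈ [a,b]} Z_t < 0 ) ≥ μ. -/

import Mathlib

open MeasureTheory ProbabilityTheory Filter Set

noncomputable section

/-- A real random variable is centered Gaussian if its law is `gaussianReal 0 v`
for some variance `v ≥ 0`. -/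
def IsCenteredGaussian {Ω : Type*} [MeasurableSpace Ω] (μ : Measure Ω) (X : Ω → ℝ) : Prop :=
  ∃ v : NNReal, Measure.map X μ = gaussianReal 0 v

/-- A centered Gaussian process: every finite linear combination of its values is a
centered Gaussian real random variable. -/
def IsCenteredGaussianProcess {Ω : Type*} [MeasurableSpace Ω] (μ : Measure Ω)
    {T : Type*} (Z : T → Ω → ℝ) : Prop :=
  ∀ (n : ℕ) (c : Fin n → ℝ) (t : Fin n → T),
    IsCenteredGaussian μ (fun ω => ∑ i, c i * Z (t i) ω)


lemma IsCenteredGaussianProcess.isGaussianProcess {Ω : Type*} [MeasurableSpace Ω] {μ : Measure Ω}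
    [IsProbabilityMeasure μ] {T : Type*} {Z : T → Ω → ℝ} (h : IsCenteredGaussianProcess μ Z) :
    IsGaussianProcess Z μ := by
  have hm : ∀ t, AEMeasurable (Z t) μ := by
    intro t
    obtain ⟨v, hv⟩ := h 1 (fun _ => 1) (fun _ => t)
    simp only [Finset.univ_unique, one_mul, Finset.sum_const, Finset.card_singleton, one_smul] at hv
    exact aemeasurable_of_map_neZero (by
      rw [hv]; infer_instance)
  refine ⟨fun I => ⟨isGaussian_of_map_eq_gaussianReal fun L => ?_⟩⟩
  have hmI : AEMeasurable (fun ω ↦ I.restrict (Z · ω)) μ :=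
    aemeasurable_pi_lambda _ (fun i => hm i)
  classical
  obtain ⟨v, hv⟩ := h (Fintype.card I) (fun k => L (Pi.single ((Fintype.equivFin I).symm k) 1))
    (fun k => ((Fintype.equivFin I).symm k : T))
  refine ⟨0, v, ?_⟩
  rw [AEMeasurable.map_map_of_aemeasurable (by fun_prop) hmI, ← hv]
  congr 1
  ext ω
  rw [Equiv.sum_comp (Fintype.equivFin I).symm (fun i : I => L (Pi.single i 1) * Z i ω)]
  simp only [Function.comp]
  conv_lhs => rw [← Finset.univ_sum_single (I.restrict fun x => Z x ω)]
  rw [map_sum]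
  refine Finset.sum_congr rfl fun i _ => ?_
  have : (Pi.single i (I.restrict (fun x => Z x ω) i) : I → ℝ)
      = (Z i ω) • (Pi.single i (1:ℝ)) := by
    rw [← Pi.single_smul]; simp
  rw [this, map_smul, smul_eq_mul, mul_comm]

lemma IsCenteredGaussianProcess.eval {Ω : Type*} [MeasurableSpace Ω] {μ : Measure Ω}
    {T : Type*} {Z : T → Ω → ℝ} (h : IsCenteredGaussianProcess μ Z) (t : T) :
    IsCenteredGaussian μ (Z t) := by
  simpa [IsCenteredGaussian] using h 1 (fun _ => 1) (fun _ => t)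

lemma IsCenteredGaussian.integral_eq {Ω : Type*} [MeasurableSpace Ω] {μ : Measure Ω}
    {X : Ω → ℝ} (h : IsCenteredGaussian μ X) : ∫ ω, X ω ∂μ = 0 := by
  obtain ⟨v, hv⟩ := h
  have hm : AEMeasurable X μ := aemeasurable_of_map_neZero (by rw [hv]; infer_instance)
  have := integral_map hm (f := fun x : ℝ => x) (by fun_prop)
  rw [← this, hv, integral_id_gaussianReal]

lemma IsCenteredGaussian.map_eq {Ω : Type*} [MeasurableSpace Ω] {μ : Measure Ω}
    {X : Ω → ℝ} (h : IsCenteredGaussian μ X) :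
    Measure.map X μ = gaussianReal 0 (∫ ω, X ω ^ 2 ∂μ).toNNReal := by
  obtain ⟨v, hv⟩ := h
  have hm : AEMeasurable X μ := aemeasurable_of_map_neZero (by rw [hv]; infer_instance)
  have := integral_map hm (f := fun x : ℝ => x ^ 2) (by fun_prop)
  have h2 := variance_fun_id_gaussianReal (μ := 0) (v := v)
  rw [variance_of_integral_eq_zero (by fun_prop) (by simp)] at h2
  rw [← this, hv, h2, Real.toNNReal_coe]

lemma IsCenteredGaussian.memLp {Ω : Type*} [MeasurableSpace Ω] {μ : Measure Ω}
    {X : Ω → ℝ} (h : IsCenteredGaussian μ X) : MemLp X 2 μ := by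
  obtain ⟨v, hv⟩ := h
  have : HasGaussianLaw X μ := ⟨by rw [hv]; infer_instance⟩
  exact this.memLp_two

lemma IsCenteredGaussian.map_div {Ω : Type*} [MeasurableSpace Ω] {μ : Measure Ω}
    {X : Ω → ℝ} (h : IsCenteredGaussian μ X) (hpos : 0 < ∫ ω, X ω ^ 2 ∂μ) :
    Measure.map (fun ω => X ω / √(∫ ω, X ω ^ 2 ∂μ)) μ = gaussianReal 0 1 := by
  have h1 := h.map_eq
  have hm := h.memLp.1.aemeasurable
  set V := ∫ ω, X ω ^ 2 ∂μ with hV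
  have : Measure.map (fun ω => X ω / √V) μ
      = Measure.map (fun x => x / √V) (Measure.map X μ) := by
    rw [AEMeasurable.map_map_of_aemeasurable (by fun_prop) hm]; rfl
  rw [this, h1, gaussianReal_map_div_const, zero_div]
  congr 1
  apply NNReal.eq
  rw [NNReal.coe_div, Real.coe_toNNReal _ hpos.le]
  change V / (√V) ^ 2 = 1
  rw [Real.sq_sqrt hpos.le, div_self hpos.ne']

lemma gaussian_bounded_var {Ω ι : Type*} [MeasurableSpace Ω] {μ : Measure Ω}
    [IsProbabilityMeasure μ] {X : ι → Ω → ℝ} (hX : ∀ i, IsCenteredGaussian μ (X i))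
    (hb : ∀ ω, ∃ K : ℝ, ∀ i, |X i ω| ≤ K) : ∃ C : ℝ, ∀ i, ∫ ω, X i ω ^ 2 ∂μ ≤ C := by
  by_contra! hcon
  choose j hj using fun n : ℕ => hcon (((n:ℝ) + 1) ^ 2)
  set s : ℕ → ℝ := fun n => √(∫ ω, X (j n) ω ^ 2 ∂μ) with hs
  have hs1 : ∀ n : ℕ, (n:ℝ) + 1 ≤ s n := fun n => Real.le_sqrt_of_sq_le (hj n).le
  have hs0 : ∀ n, 0 < s n := fun n => lt_of_lt_of_le (by positivity) (hs1 n)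
  have hlaw : ∀ n, Measure.map (fun ω => X (j n) ω / s n) μ = gaussianReal 0 1 := by
    intro n
    exact (hX (j n)).map_div (lt_trans (by positivity) (hj n))
  have hlim : Tendsto (fun n => ∫ ω, Complex.exp (((X (j n) ω / s n : ℝ) : ℂ) * Complex.I) ∂μ) atTop
      (nhds (∫ ω, (1:ℂ) ∂μ)) := by
    refine tendsto_integral_of_dominated_convergence (fun _ => 1) ?_ (by simp) ?_ ?_
    · intro n
      have hm := (hX (j n)).memLp.1.aemeasurable
      have : AEMeasurable (fun ω => Complex.exp (((X (j n) ω / s n : ℝ) : ℂ) * Complex.I)) μ := by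
        fun_prop
      exact this.aestronglyMeasurable
    · intro n
      refine ae_of_all _ fun ω => ?_
      rw [Complex.norm_exp_ofReal_mul_I]
    · refine ae_of_all _ fun ω => ?_
      obtain ⟨K, hK⟩ := hb ω
      have h0 : Tendsto (fun n => X (j n) ω / s n) atTop (nhds 0) := by
        refine squeeze_zero_norm (a := fun n : ℕ => K * (1 / ((n:ℝ) + 1))) ?_ ?_
        · intro n
          rw [Real.norm_eq_abs, abs_div, abs_of_pos (hs0 n), div_eq_mul_one_div]
          have hK0 : 0 ≤ K := (abs_nonneg _).trans (hK (j n))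
          exact mul_le_mul (hK _) (one_div_le_one_div_of_le (by positivity) (hs1 n))
            (by have := hs0 n; positivity) hK0
        · simpa using tendsto_one_div_add_atTop_nhds_zero_nat.const_mul K
      have hc : Continuous fun x : ℝ => Complex.exp ((x : ℂ) * Complex.I) := by fun_prop
      have := (hc.tendsto 0).comp h0
      simpa [Function.comp_def] using this
  have hval : ∀ n, ∫ ω, Complex.exp (((X (j n) ω / s n : ℝ) : ℂ) * Complex.I) ∂μ
      = Complex.exp (-(1/2)) := by
    intro n
    have hm := (hX (j n)).memLp.1.aemeasurable
    have h1 := integral_map (μ := μ) (φ := fun ω => X (j n) ω / s n) (by fun_prop)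
      (f := fun x : ℝ => Complex.exp ((x : ℂ) * Complex.I)) (by fun_prop)
    rw [← h1, hlaw]
    have h2 := charFun_gaussianReal (μ := 0) (v := 1) 1
    rw [charFun_apply_real] at h2
    simp only [Complex.ofReal_one, one_mul] at h2
    rw [h2]; congr 1; simp
  simp only [hval] at hlim
  have := tendsto_nhds_unique hlim tendsto_const_nhds
  simp at this
  have h3 := congrArg norm this
  rw [Complex.norm_exp] at h3
  simp at h3
  have := (Real.exp_eq_one_iff _).1 h3.symm
  norm_num at this

lemma fatou_sq {Ω : Type*} [MeasurableSpace Ω] {μ : Measure Ω}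
    {X : ℕ → Ω → ℝ} {Y : Ω → ℝ} {C : ℝ} (hX : ∀ n, Integrable (fun ω => X n ω ^ 2) μ)
    (hC : ∀ n, ∫ ω, X n ω ^ 2 ∂μ ≤ C)
    (hlim : ∀ ω, Tendsto (fun n => X n ω) atTop (nhds (Y ω))) :
    ∫ ω, Y ω ^ 2 ∂μ ≤ C := by
  have hC0 : 0 ≤ C := (integral_nonneg fun _ => sq_nonneg _).trans (hC 0)
  have hYm : AEStronglyMeasurable (fun ω => Y ω ^ 2) μ :=
    aestronglyMeasurable_of_tendsto_ae atTop (fun n => (hX n).1)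
      (ae_of_all _ fun ω => (hlim ω).pow 2)
  rw [integral_eq_lintegral_of_nonneg_ae (ae_of_all _ fun _ => sq_nonneg _) hYm]
  refine ENNReal.toReal_le_of_le_ofReal hC0 ?_
  calc ∫⁻ ω, ENNReal.ofReal (Y ω ^ 2) ∂μ
      = ∫⁻ ω, liminf (fun n => ENNReal.ofReal (X n ω ^ 2)) atTop ∂μ := by
        refine lintegral_congr fun ω => ?_
        exact ((ENNReal.continuous_ofReal.tendsto _).comp ((hlim ω).pow 2)).liminf_eq.symm
    _ ≤ liminf (fun n => ∫⁻ ω, ENNReal.ofReal (X n ω ^ 2) ∂μ) atTop :=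
        lintegral_liminf_le' fun n => (hX n).1.aemeasurable.ennreal_ofReal
    _ ≤ liminf (fun n : ℕ => ENNReal.ofReal C) atTop := by
        refine liminf_le_liminf (Eventually.of_forall fun n => ?_)
        rw [← ofReal_integral_eq_lintegral_ofReal (hX n) (ae_of_all _ fun _ => sq_nonneg _)]
        exact ENNReal.ofReal_le_ofReal (hC n)
    _ = ENNReal.ofReal C := by simp


lemma riemann_tendsto {f f' : ℝ → ℝ} {s t : ℝ} (hst : s ≤ t)
    (hd : ∀ x ∈ Icc s t, HasDerivAt f (f' x) x) (hc : ContinuousOn f' (Icc s t)) :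
    Tendsto (fun n : ℕ => (t - s) / ((n:ℝ) + 1) *
      ∑ k ∈ Finset.range (n+1), f' (s + k * ((t - s) / ((n:ℝ) + 1)))) atTop (nhds (f t - f s)) := by
  have huc := isCompact_Icc.uniformContinuousOn_of_continuous hc
  rw [Metric.uniformContinuousOn_iff] at huc
  rw [Metric.tendsto_atTop]
  intro ε hε
  have hts : 0 ≤ t - s := sub_nonneg.2 hst
  obtain ⟨δ, hδ, hδ'⟩ := huc (ε / (t - s + 1)) (by positivity)
  obtain ⟨N, hN⟩ := exists_nat_gt ((t - s) / δ)
  refine ⟨N, fun n hn => ?_⟩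
  set h : ℝ := (t - s) / ((n:ℝ) + 1) with hh
  have hn1 : (0:ℝ) < (n:ℝ) + 1 := by positivity
  have hnh : ((n:ℝ) + 1) * h = t - s := by rw [hh]; field_simp
  have hh0 : 0 ≤ h := by positivity
  have hhδ : h < δ := by
    rw [hh, div_lt_iff₀ hn1]
    rw [div_lt_iff₀ hδ] at hN
    have : (N:ℝ) ≤ n := by exact_mod_cast hn
    nlinarith
  have htel : f t - f s = ∑ k ∈ Finset.range (n+1), (f (s + (k+1:ℕ) * h) - f (s + k * h)) := by
    rw [Finset.sum_range_sub (fun k : ℕ => f (s + k * h))]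
    push_cast
    rw [hnh]; simp
  rw [dist_comm, Real.dist_eq, htel, Finset.mul_sum, ← Finset.sum_sub_distrib]
  have hterm : ∀ k ∈ Finset.range (n+1),
      |f (s + (k+1:ℕ) * h) - f (s + k * h) - h * f' (s + k * h)| ≤ ε / (t - s + 1) * h := by
    intro k hk
    have hk' : (k:ℝ) + 1 ≤ (n:ℝ) + 1 := by
      have := Finset.mem_range.1 hk
      exact_mod_cast this
    have hk0 : (0:ℝ) ≤ k := by positivity
    set u := s + k * h with hu
    have hu1 : s + (k+1:ℕ) * h = u + h := by push_cast; rw [hu]; ring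
    have hsu : s ≤ u := by rw [hu]; nlinarith
    have hut : u + h ≤ t := by rw [hu]; nlinarith
    rw [hu1]
    have key := Convex.norm_image_sub_le_of_norm_hasDerivWithin_le
      (f := fun x => f x - f' u * x) (f' := fun x => f' x - f' u) (C := ε / (t - s + 1))
      (s := Icc u (u + h)) (x := u) (y := u + h) ?_ ?_ (convex_Icc _ _)
      (by simp [hh0]) (by simp [hh0])
    · simp only [Real.norm_eq_abs, add_sub_cancel_left, abs_of_nonneg hh0] at key
      refine le_trans (le_of_eq ?_) key
      congr 1; ring
    · intro x hx
      have := (hd x ⟨hsu.trans hx.1, hx.2.trans hut⟩).sub ((hasDerivAt_id x).const_mul (f' u))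
      rw [mul_one] at this
      exact this.hasDerivWithinAt
    · intro x hx
      rw [← dist_eq_norm]
      refine (hδ' x ⟨hsu.trans hx.1, hx.2.trans hut⟩ u ⟨hsu, by linarith⟩ ?_).le
      rw [Real.dist_eq, abs_of_nonneg (by linarith [hx.1])]
      linarith [hx.2]
  calc _ ≤ ∑ k ∈ Finset.range (n+1), |f (s + (k+1:ℕ) * h) - f (s + k * h) - h * f' (s + k * h)| :=
        Finset.abs_sum_le_sum_abs _ _
    _ ≤ ∑ k ∈ Finset.range (n+1), ε / (t - s + 1) * h := Finset.sum_le_sum hterm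
    _ = ε / (t - s + 1) * (t - s) := by
        simp only [Finset.sum_const, Finset.card_range, nsmul_eq_mul]
        rw [← hnh]; push_cast; ring
    _ < ε := by
        rw [div_mul_eq_mul_div, div_lt_iff₀ (by linarith)]
        nlinarith

lemma incr_le {Ω : Type*} [MeasurableSpace Ω] {μ : Measure Ω}
    {Z Z' : ℝ → Ω → ℝ} {s t D : ℝ} (hst : s ≤ t)
    (hd : ∀ ω, ∀ u ∈ Icc s t, HasDerivAt (fun s => Z s ω) (Z' u ω) u)
    (hc : ∀ ω, ContinuousOn (fun t => Z' t ω) (Icc s t))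
    (hi : ∀ u ∈ Icc s t, Integrable (fun ω => (Z' u ω) ^ 2) μ)
    (hm : ∀ u ∈ Icc s t, AEMeasurable (Z' u) μ)
    (hD : ∀ u ∈ Icc s t, ∫ ω, Z' u ω ^ 2 ∂μ ≤ D) :
    ∫ ω, (Z t ω - Z s ω) ^ 2 ∂μ ≤ (t - s) ^ 2 * D := by
  have hts : 0 ≤ t - s := sub_nonneg.2 hst
  have hmem : ∀ n : ℕ, ∀ k ∈ Finset.range (n+1), s + k * ((t - s) / ((n:ℝ) + 1)) ∈ Icc s t := by
    intro n k hk
    have hk' : (k:ℝ) ≤ (n:ℝ) + 1 := by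
      have := (Finset.mem_range.1 hk).le
      exact_mod_cast this
    have hn1 : (0:ℝ) < (n:ℝ) + 1 := by positivity
    constructor
    · have : 0 ≤ k * ((t - s) / ((n:ℝ) + 1)) := by positivity
      linarith
    · have : k * ((t - s) / ((n:ℝ) + 1)) ≤ (n + 1) * ((t - s) / ((n:ℝ) + 1)) := by gcongr
      have h2 : ((n:ℝ) + 1) * ((t - s) / ((n:ℝ) + 1)) = t - s := by field_simp
      linarith
  have hL : ∀ n : ℕ, MemLp (fun ω => (t - s) / ((n:ℝ) + 1) *
      ∑ k ∈ Finset.range (n+1), Z' (s + k * ((t - s) / ((n:ℝ) + 1))) ω) 2 μ := by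
    intro n
    refine MemLp.const_mul (f := fun ω => ∑ k ∈ Finset.range (n+1),
      Z' (s + k * ((t - s) / ((n:ℝ) + 1))) ω) ?_ _
    refine memLp_finsetSum (f := fun k : ℕ => Z' (s + k * ((t - s) / ((n:ℝ) + 1)))) _ ?_
    intro k hk
    have := hmem n k hk
    exact (memLp_two_iff_integrable_sq (hm _ this).aestronglyMeasurable).2 (hi _ this)
  refine fatou_sq (fun n => (hL n).integrable_sq) ?_ (fun ω => riemann_tendsto hst (hd ω) (hc ω))
  intro n
  have hn1 : (0:ℝ) < (n:ℝ) + 1 := by positivity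
  calc _ ≤ ∫ ω, ((t - s) / ((n:ℝ) + 1)) ^ 2 * (((n:ℝ) + 1) *
        ∑ k ∈ Finset.range (n+1), Z' (s + k * ((t - s) / ((n:ℝ) + 1))) ω ^ 2) ∂μ := by
        refine integral_mono (hL n).integrable_sq ?_ ?_
        · exact ((integrable_finsetSum _ fun k hk => hi _ (hmem n k hk)).const_mul _).const_mul _
        · intro ω
          simp only [mul_pow]
          refine mul_le_mul_of_nonneg_left ?_ (by positivity)
          have := sq_sum_le_card_mul_sum_sq (s := Finset.range (n+1))
            (f := fun k : ℕ => Z' (s + k * ((t - s) / ((n:ℝ) + 1))) ω)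
          simpa using this
    _ = ((t - s) / ((n:ℝ) + 1)) ^ 2 * (((n:ℝ) + 1) *
        ∑ k ∈ Finset.range (n+1), ∫ ω, Z' (s + k * ((t - s) / ((n:ℝ) + 1))) ω ^ 2 ∂μ) := by
        rw [integral_const_mul, integral_const_mul, integral_finsetSum]
        exact fun k hk => hi _ (hmem n k hk)
    _ ≤ ((t - s) / ((n:ℝ) + 1)) ^ 2 * (((n:ℝ) + 1) * ∑ k ∈ Finset.range (n+1), D) := by
        gcongr with k hk
        exact hD _ (hmem n k hk)
    _ = (t - s) ^ 2 * D := by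
        simp only [Finset.sum_const, Finset.card_range, nsmul_eq_mul]
        push_cast
        field_simp

lemma resid_le {Ω : Type*} [MeasurableSpace Ω] {μ : Measure Ω} {U X : Ω → ℝ}
    (hU : MemLp U 2 μ) (hX : MemLp X 2 μ) (hV : 0 < ∫ ω, X ω ^ 2 ∂μ) :
    ∫ ω, (U ω - (∫ ω, U ω * X ω ∂μ) / (∫ ω, X ω ^ 2 ∂μ) * X ω) ^ 2 ∂μ ≤ ∫ ω, U ω ^ 2 ∂μ := by
  set V := ∫ ω, X ω ^ 2 ∂μ with hVd
  set c := ∫ ω, U ω * X ω ∂μ with hcd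
  have h1 : ∀ ω, (U ω - c / V * X ω) ^ 2
      = U ω ^ 2 - 2 * (c / V) * (U ω * X ω) + (c / V) ^ 2 * X ω ^ 2 := fun ω => by ring
  have hUX : Integrable (fun ω => U ω * X ω) μ := hU.integrable_mul hX
  simp only [h1]
  have hi1 : Integrable (fun ω => U ω ^ 2 - 2 * (c / V) * (U ω * X ω)) μ :=
    hU.integrable_sq.sub (hUX.const_mul _)
  rw [integral_add hi1 (hX.integrable_sq.const_mul _),
    integral_sub hU.integrable_sq (hUX.const_mul _), integral_const_mul, integral_const_mul,
    ← hVd, ← hcd]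
  have : 2 * (c / V) * c - (c / V) ^ 2 * V = c ^ 2 / V := by field_simp; ring
  have h2 : 0 ≤ c ^ 2 / V := by positivity
  linarith


lemma deriv_bound {Ω : Type*} [MeasurableSpace Ω] {μ : Measure Ω} [IsProbabilityMeasure μ]
    {Z Z' : ℝ → Ω → ℝ} {a b : ℝ} (hab : a < b) (hZ : IsCenteredGaussianProcess μ Z)
    (hd : ∀ ω, ∀ t ∈ Icc a b, HasDerivAt (fun s => Z s ω) (Z' t ω) t)
    (hc : ∀ ω, ContinuousOn (fun t => Z' t ω) (Icc a b)) :
    (∀ t ∈ Icc a b, AEMeasurable (Z' t) μ) ∧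
      ∃ C : ℝ, ∀ t ∈ Icc a b, ∫ ω, Z' t ω ^ 2 ∂μ ≤ C := by
  let ι := {p : ℝ × ℝ // p.1 ∈ Icc a b ∧ p.2 ∈ Icc a b ∧ p.1 ≠ p.2}
  let X : ι → Ω → ℝ := fun p ω => (p.1.1 - p.1.2)⁻¹ * (Z p.1.1 ω - Z p.1.2 ω)
  have hX : ∀ p, IsCenteredGaussian μ (X p) := by
    intro p
    have := hZ 2 ![(p.1.1 - p.1.2)⁻¹, -(p.1.1 - p.1.2)⁻¹] ![p.1.1, p.1.2]
    convert this using 2 with ω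
    simp [X, Fin.sum_univ_two]
    ring
  have hb : ∀ ω, ∃ K : ℝ, ∀ p, |X p ω| ≤ K := by
    intro ω
    obtain ⟨K, hK⟩ := isCompact_Icc.exists_bound_of_continuousOn (hc ω)
    refine ⟨K, fun p => ?_⟩
    obtain ⟨⟨u, v⟩, hu, hv, huv⟩ := p
    have := Convex.norm_image_sub_le_of_norm_hasDerivWithin_le (f := fun s => Z s ω)
      (fun x hx => (hd ω x hx).hasDerivWithinAt) hK (convex_Icc a b) hv hu
    simp only [Real.norm_eq_abs] at this
    simp only [X, abs_mul, abs_inv]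
    have h0 : 0 < |u - v| := abs_pos.2 (sub_ne_zero.2 huv)
    rw [inv_mul_le_iff₀ h0]
    linarith
  obtain ⟨C, hC⟩ := gaussian_bounded_var hX hb
  have hseq : ∀ t ∈ Icc a b, ∃ q : ℕ → ι, ∀ ω, Tendsto (fun n => X (q n) ω) atTop (nhds (Z' t ω)) := by
    intro t ht
    obtain ⟨c, hcm, hct⟩ : ∃ c ∈ Icc a b, c ≠ t := by
      by_cases h : t = a
      · exact ⟨b, ⟨hab.le, le_rfl⟩, by rw [h]; exact hab.ne'⟩
      · exact ⟨a, ⟨le_rfl, hab.le⟩, fun h' => h h'.symm⟩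
    have hne : ∀ n : ℕ, t + (1 / ((n:ℝ) + 1)) * (c - t) ≠ t := by
      intro n h
      have h1 : (1 / ((n:ℝ) + 1)) * (c - t) = 0 := by linarith
      rcases mul_eq_zero.1 h1 with h2 | h2
      · have : (0:ℝ) < 1 / ((n:ℝ) + 1) := by positivity
        linarith
      · exact hct (by linarith)
    have hmem : ∀ n : ℕ, t + (1 / ((n:ℝ) + 1)) * (c - t) ∈ Icc a b := by
      intro n
      have h1 : (0:ℝ) < 1 / ((n:ℝ) + 1) := by positivity
      have h2 : 1 / ((n:ℝ) + 1) ≤ 1 := by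
        rw [div_le_one (by positivity)]; linarith [Nat.cast_nonneg (α := ℝ) n]
      obtain ⟨h3, h4⟩ := ht
      obtain ⟨h5, h6⟩ := hcm
      constructor <;> nlinarith
    refine ⟨fun n => ⟨(t + (1 / ((n:ℝ) + 1)) * (c - t), t), hmem n, ht, hne n⟩, fun ω => ?_⟩
    have h1 := hasDerivAt_iff_tendsto_slope.1 (hd ω t ht)
    have h2 : Tendsto (fun n : ℕ => t + (1 / ((n:ℝ) + 1)) * (c - t)) atTop (nhdsWithin t {t}ᶜ) := by
      refine tendsto_nhdsWithin_iff.2 ⟨?_, Eventually.of_forall hne⟩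
      have := (tendsto_one_div_add_atTop_nhds_zero_nat (𝕜 := ℝ)).mul_const (c - t)
      simpa using this.const_add t
    have h3 := h1.comp h2
    refine h3.congr fun n => ?_
    simp [X, slope]
  refine ⟨fun t ht => ?_, C, fun t ht => ?_⟩
  · obtain ⟨q, hq⟩ := hseq t ht
    exact aemeasurable_of_tendsto_metrizable_ae atTop (fun n => (hX (q n)).memLp.1.aemeasurable)
      (ae_of_all _ hq)
  · obtain ⟨q, hq⟩ := hseq t ht
    exact fatou_sq (fun n => (hX (q n)).memLp.integrable_sq) (fun n => hC (q n)) hq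

lemma sq_le_of_increments (y : ℕ → ℝ) (N k : ℕ) (hk : k ≤ N) :
    y k ^ 2 ≤ 2 * y 0 ^ 2 + 2 * (N * ∑ i ∈ Finset.range N, (y (i + 1) - y i) ^ 2) := by
  have h1 : y k = y 0 + ∑ i ∈ Finset.range k, (y (i + 1) - y i) := by
    rw [Finset.sum_range_sub]; ring
  have h2 := sq_sum_le_card_mul_sum_sq (s := Finset.range k) (f := fun i => y (i + 1) - y i)
  rw [Finset.card_range] at h2
  have h3 : (k:ℝ) * ∑ i ∈ Finset.range k, (y (i + 1) - y i) ^ 2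
      ≤ N * ∑ i ∈ Finset.range N, (y (i + 1) - y i) ^ 2 := by
    refine mul_le_mul (by exact_mod_cast hk) ?_ (Finset.sum_nonneg fun _ _ => sq_nonneg _)
      (by positivity)
    exact Finset.sum_le_sum_of_subset_of_nonneg (Finset.range_mono hk)
      (fun _ _ _ => sq_nonneg _)
  have h4 := sq_nonneg (y 0 - ∑ i ∈ Finset.range k, (y (i + 1) - y i))
  rw [h1]
  nlinarith

lemma grid_bound {Ω : Type*} [MeasurableSpace Ω] {μ : Measure Ω} [IsProbabilityMeasure μ]
    {Z : ℝ → Ω → ℝ} (hZ : IsCenteredGaussianProcess μ Z) (τ : ℕ → ℝ) (N : ℕ) (hN : 0 < N)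
    (t₀ S : ℝ) (hS : 0 < S) (hV1 : 3 / 4 * S < ∫ ω, Z t₀ ω ^ 2 ∂μ)
    (hV2 : ∫ ω, Z t₀ ω ^ 2 ∂μ ≤ S)
    (h1 : ∀ k ≤ N, ∫ ω, (Z (τ k) ω - Z t₀ ω) ^ 2 ∂μ ≤ S / 2)
    (h2 : ∀ k < N, ∫ ω, (Z (τ (k + 1)) ω - Z (τ k) ω) ^ 2 ∂μ ≤ S / (2 * N ^ 2)) :
    (gaussianReal 0 1 (Iio (-64))).toReal / 2 ≤
      (μ {ω | ∀ k ≤ N, Z (τ k) ω ≤ - 2 * √S}).toReal := by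
  have hL : ∀ t, MemLp (Z t) 2 μ := fun t => (hZ.eval t).memLp
  set X : Ω → ℝ := Z t₀ with hXd
  set V : ℝ := ∫ ω, X ω ^ 2 ∂μ with hVd
  have hVpos : 0 < V := by linarith
  set ρ : ℝ → ℝ := fun t => (∫ ω, Z t ω * X ω ∂μ) / V with hρ
  set Y : ℝ → Ω → ℝ := fun t ω => Z t ω - ρ t * X ω with hY
  have hYL : ∀ t, MemLp (Y t) 2 μ := fun t => (hL t).sub ((hL t₀).const_mul _)
  have hZX : ∀ t, Integrable (fun ω => Z t ω * X ω) μ := fun t => (hL t).integrable_mul (hL t₀)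
  -- lower bound on the regression coefficient
  have hρ1 : ∀ k ≤ N, 1 / 8 ≤ ρ (τ k) := by
    intro k hk
    have e1 : ∫ ω, (Z (τ k) ω - X ω) ^ 2 ∂μ
        = ∫ ω, Z (τ k) ω ^ 2 ∂μ - 2 * ∫ ω, Z (τ k) ω * X ω ∂μ + V := by
      have : ∀ ω, (Z (τ k) ω - X ω) ^ 2
        = Z (τ k) ω ^ 2 - 2 * (Z (τ k) ω * X ω) + X ω ^ 2 := fun ω => by ring
      simp only [this]
      have hi : Integrable (fun ω => Z (τ k) ω ^ 2 - 2 * (Z (τ k) ω * X ω)) μ :=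
        (hL _).integrable_sq.sub ((hZX _).const_mul _)
      rw [integral_add hi (hL t₀).integrable_sq,
        integral_sub (hL _).integrable_sq ((hZX _).const_mul _), integral_const_mul]
    have e2 := h1 k hk
    have e3 : 0 ≤ ∫ ω, Z (τ k) ω ^ 2 ∂μ := integral_nonneg fun _ => sq_nonneg _
    simp only [hρ]
    rw [le_div_iff₀ hVpos]
    linarith
  -- independence
  have hind : IndepFun (fun ω t ↦ Y t ω) (fun ω (_ : Unit) ↦ X ω) μ := by
    refine IsGaussianProcess.indepFun_of_covariance_eq_zero (X := Y) (Y := fun _ : Unit => X) ?_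
      (fun t => (hYL t).1.aemeasurable) (fun _ => (hL t₀).1.aemeasurable) ?_
    · refine hZ.isGaussianProcess.of_isGaussianProcess ?_
      rintro (t | u)
      · refine ⟨{t, t₀}, ContinuousLinearMap.proj ⟨t, by simp⟩
          - ρ t • ContinuousLinearMap.proj ⟨t₀, by simp⟩, fun ω => ?_⟩
        simp [Y, X, Finset.restrict_def]
      · refine ⟨{t₀}, ContinuousLinearMap.proj ⟨t₀, by simp⟩, fun ω => ?_⟩
        simp [X, Finset.restrict_def]
    · intro t _
      rw [covariance_eq_sub (hYL t) (hL t₀), (hZ.eval t₀).integral_eq, mul_zero, sub_zero]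
      have : ∀ ω, (Y t * X) ω = Z t ω * X ω - ρ t * X ω ^ 2 := fun ω => by
        simp [Y]; ring
      change ∫ ω, (Y t * X) ω ∂μ = 0
      simp only [this]
      rw [integral_sub (hZX t) ((hL t₀).integrable_sq.const_mul _), integral_const_mul]
      simp only [hρ]
      rw [← hVd]
      field_simp
      ring
  let W : Ω → ℝ := fun ω => 2 * Y (τ 0) ω ^ 2 +
    2 * (N * ∑ i ∈ Finset.range N, (Y (τ (i + 1)) ω - Y (τ i) ω) ^ 2)
  have hindW : IndepFun W X μ := by
    let φ : (ℝ → ℝ) → ℝ := fun y => 2 * y (τ 0) ^ 2 +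
      2 * (N * ∑ i ∈ Finset.range N, (y (τ (i + 1)) - y (τ i)) ^ 2)
    have hφ : Measurable φ := by fun_prop
    exact hind.comp (φ := φ) (ψ := fun y : Unit → ℝ => y ()) hφ (by fun_prop)
  -- expectation of W
  have hYi : ∀ s t, Integrable (fun ω => (Y s ω - Y t ω) ^ 2) μ := fun s t =>
    ((hYL s).sub (hYL t)).integrable_sq
  have hWi1 : Integrable (fun ω => 2 * Y (τ 0) ω ^ 2) μ := (hYL _).integrable_sq.const_mul _
  have hWi2 : Integrable (fun ω =>
      2 * (N * ∑ i ∈ Finset.range N, (Y (τ (i + 1)) ω - Y (τ i) ω) ^ 2)) μ :=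
    ((integrable_finsetSum _ fun i _ => hYi _ _).const_mul _).const_mul _
  have hWi : Integrable W μ := hWi1.add hWi2
  have hY0 : ∫ ω, Y (τ 0) ω ^ 2 ∂μ ≤ S / 2 := by
    refine le_trans (le_trans (le_of_eq ?_) (resid_le ((hL (τ 0)).sub (hL t₀)) (hL t₀) hVpos))
      (h1 0 (Nat.zero_le _))
    have e1 : ∫ ω, (Z (τ 0) - Z t₀) ω * Z t₀ ω ∂μ = (∫ ω, Z (τ 0) ω * X ω ∂μ) - V := by
      rw [hVd, ← integral_sub (hZX _) (hL t₀).integrable_sq]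
      congr 1; ext ω; simp [X]; ring
    rw [e1]
    congr 1; ext ω
    simp only [Y, ρ, Pi.sub_apply]
    rw [← hXd, ← hVd]
    field_simp
    ring
  have hYd : ∀ k < N, ∫ ω, (Y (τ (k + 1)) ω - Y (τ k) ω) ^ 2 ∂μ ≤ S / (2 * N ^ 2) := by
    intro k hk
    refine le_trans (le_trans (le_of_eq ?_)
      (resid_le ((hL (τ (k + 1))).sub (hL (τ k))) (hL t₀) hVpos)) (h2 k hk)
    have e1 : ∫ ω, (Z (τ (k + 1)) - Z (τ k)) ω * Z t₀ ω ∂μ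
        = (∫ ω, Z (τ (k + 1)) ω * X ω ∂μ) - ∫ ω, Z (τ k) ω * X ω ∂μ := by
      rw [← integral_sub (hZX _) (hZX _)]
      congr 1; ext ω; simp [X]; ring
    rw [e1]
    congr 1; ext ω
    simp only [Y, ρ, Pi.sub_apply]
    rw [← hXd, ← hVd]
    field_simp
    ring
  have hN' : (0:ℝ) < N := by exact_mod_cast hN
  have hEW : ∫ ω, W ω ∂μ ≤ 2 * S := by
    simp only [W]
    rw [integral_add hWi1 hWi2, integral_const_mul, integral_const_mul, integral_const_mul,
      integral_finsetSum _ fun i _ => hYi _ _]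
    have : ∑ i ∈ Finset.range N, ∫ ω, (Y (τ (i + 1)) ω - Y (τ i) ω) ^ 2 ∂μ
        ≤ ∑ i ∈ Finset.range N, S / (2 * N ^ 2) :=
      Finset.sum_le_sum fun i hi => hYd i (Finset.mem_range.1 hi)
    have e : (N:ℝ) * ∑ i ∈ Finset.range N, S / (2 * N ^ 2) = S / 2 := by
      simp only [Finset.sum_const, Finset.card_range, nsmul_eq_mul]
      field_simp
    have := mul_le_mul_of_nonneg_left this hN'.le
    linarith
  have hW0 : ∀ ω, 0 ≤ W ω := fun ω => by
    have : 0 ≤ ∑ i ∈ Finset.range N, (Y (τ (i + 1)) ω - Y (τ i) ω) ^ 2 :=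
      Finset.sum_nonneg fun _ _ => sq_nonneg _
    simp only [W]; positivity
  have hPW : 1 / 2 ≤ (μ (W ⁻¹' Iio (4 * S))).toReal := by
    have hm := mul_meas_ge_le_integral_of_nonneg (ae_of_all μ hW0) hWi (4 * S)
    have hn : NullMeasurableSet (W ⁻¹' Iio (4 * S)) μ :=
      hWi.1.aemeasurable.nullMeasurableSet_preimage measurableSet_Iio
    have hc := prob_compl_eq_one_sub₀ hn
    have hset : (W ⁻¹' Iio (4 * S))ᶜ = {x | 4 * S ≤ W x} := by ext; simp
    have hr : μ.real (W ⁻¹' Iio (4 * S))ᶜ = 1 - μ.real (W ⁻¹' Iio (4 * S)) :=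
      probReal_compl_eq_one_sub₀ hn
    rw [hset] at hr
    change 1 / 2 ≤ μ.real _
    rw [hr] at hm
    by_contra! hlt
    nlinarith
  have hPX : (gaussianReal 0 1 (Iio (-64))).toReal ≤ (μ (X ⁻¹' Iio (-32 * √S))).toReal := by
    rw [← (hZ.eval t₀).map_div hVpos, Measure.map_apply_of_aemeasurable
      ((hL t₀).1.aemeasurable.div_const _) measurableSet_Iio]
    refine ENNReal.toReal_mono (measure_ne_top _ _) (measure_mono fun ω hω => ?_)
    simp only [mem_preimage, mem_Iio] at hω ⊢
    have hsV : 0 < √V := Real.sqrt_pos.2 hVpos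
    change X ω / √V < -64 at hω
    rw [div_lt_iff₀ hsV] at hω
    have : √S ≤ 2 * √V := by
      rw [Real.sqrt_le_left (by positivity), mul_pow, Real.sq_sqrt hVpos.le]
      linarith
    linarith
  have hfin : W ⁻¹' Iio (4 * S) ∩ X ⁻¹' Iio (-32 * √S) ⊆ {ω | ∀ k ≤ N, Z (τ k) ω ≤ - 2 * √S} := by
    rintro ω ⟨hw, hx⟩ k hk
    simp only [mem_preimage, mem_Iio] at hw hx
    have e1 := sq_le_of_increments (fun k => Y (τ k) ω) N k hk
    have e2 : Y (τ k) ω ^ 2 ≤ (2 * √S) ^ 2 := by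
      rw [mul_pow, Real.sq_sqrt hS.le]
      exact e1.trans (by have := hw.le; simp only [W] at this; linarith)
    have e3 := (abs_le_of_sq_le_sq' e2 (by positivity)).2
    have e4 := hρ1 k hk
    have e5 : Z (τ k) ω = Y (τ k) ω + ρ (τ k) * X ω := by simp [Y]
    have hs := Real.sqrt_pos.2 hS
    have e6 : ρ (τ k) * X ω ≤ 1 / 8 * (-32 * √S) := by nlinarith
    linarith
  calc _ = 1 / 2 * (gaussianReal 0 1 (Iio (-64))).toReal := by ring
    _ ≤ (μ (W ⁻¹' Iio (4 * S))).toReal * (μ (X ⁻¹' Iio (-32 * √S))).toReal := by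
      gcongr
    _ = (μ (W ⁻¹' Iio (4 * S) ∩ X ⁻¹' Iio (-32 * √S))).toReal := by
      rw [hindW.measure_inter_preimage_eq_mul _ _ measurableSet_Iio measurableSet_Iio,
        ENNReal.toReal_mul]
    _ ≤ _ := ENNReal.toReal_mono (measure_ne_top _ _) (measure_mono hfin)

/-- **Uniform lower bound on the no-crossing probability.** There is a universal `c > 0`
such that for any centered Gaussian process on `[a,b]` with `C¹` sample paths (with
derivative `Z'` having finite second moments), if `0 < sup_t E[Z_t²]` and
`2 (b-a)² sup_t E[(Z'_t)²] ≤ sup_t E[Z_t²]`, then `P(sup_{[a,b]} Z < 0) ≥ c`. -/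
theorem gaussian_negativity_lower_bound :
    ∃ c : ℝ, 0 < c ∧ ∀ (a b : ℝ), a < b →
      ∀ (Ω : Type) [MeasurableSpace Ω] (μ : Measure Ω) [IsProbabilityMeasure μ]
        (Z Z' : ℝ → Ω → ℝ),
        IsCenteredGaussianProcess μ Z →
        (∀ ω, ∀ t ∈ Icc a b, HasDerivAt (fun s => Z s ω) (Z' t ω) t) →
        (∀ ω, ContinuousOn (fun t => Z' t ω) (Icc a b)) →
        (∀ t ∈ Icc a b, Integrable (fun ω => (Z' t ω) ^ 2) μ) →
        (0 < ⨆ t : Icc a b, ∫ ω, (Z t.1 ω) ^ 2 ∂μ) →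
        (2 * (b - a) ^ 2 * ⨆ t : Icc a b, ∫ ω, (Z' t.1 ω) ^ 2 ∂μ) ≤
          (⨆ t : Icc a b, ∫ ω, (Z t.1 ω) ^ 2 ∂μ) →
        c ≤ (μ {ω | ∀ t ∈ Icc a b, Z t ω < 0}).toReal := by
  have hpos : 0 < (gaussianReal 0 1 (Iio (-64))).toReal := by
    refine ENNReal.toReal_pos ?_ (measure_ne_top _ _)
    intro h0
    have := gaussianReal_absolutelyContinuous' 0 (one_ne_zero : (1 : NNReal) ≠ 0) h0
    simp at this
  refine ⟨(gaussianReal 0 1 (Iio (-64))).toReal / 2, by positivity, ?_⟩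
  intro a b hab Ω _ μ _ Z Z' hZ hd hc hi hS hle
  obtain ⟨hm, C, hC⟩ := deriv_bound hab hZ hd hc
  haveI : Nonempty (Icc a b) := ⟨⟨a, left_mem_Icc.2 hab.le⟩⟩
  have hbS : BddAbove (range fun t : Icc a b => ∫ ω, (Z t.1 ω) ^ 2 ∂μ) := by
    by_contra hn
    rw [Real.iSup_of_not_bddAbove hn] at hS
    exact lt_irrefl _ hS
  have hbD : BddAbove (range fun t : Icc a b => ∫ ω, (Z' t.1 ω) ^ 2 ∂μ) := by
    refine ⟨C, ?_⟩
    rintro _ ⟨t, rfl⟩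
    exact hC t.1 t.2
  have hD : ∀ t ∈ Icc a b, ∫ ω, Z' t ω ^ 2 ∂μ ≤ ⨆ t : Icc a b, ∫ ω, (Z' t.1 ω) ^ 2 ∂μ :=
    fun t ht => le_ciSup hbD ⟨t, ht⟩
  have hSle : ∀ t ∈ Icc a b, ∫ ω, Z t ω ^ 2 ∂μ ≤ ⨆ t : Icc a b, ∫ ω, (Z t.1 ω) ^ 2 ∂μ :=
    fun t ht => le_ciSup hbS ⟨t, ht⟩
  have hex : ∃ t : Icc a b, 3 / 4 * (⨆ t : Icc a b, ∫ ω, (Z t.1 ω) ^ 2 ∂μ)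
      < ∫ ω, (Z t.1 ω) ^ 2 ∂μ := exists_lt_of_lt_ciSup (by linarith)
  generalize (⨆ t : Icc a b, ∫ ω, (Z t.1 ω) ^ 2 ∂μ) = S at *
  generalize (⨆ t : Icc a b, ∫ ω, (Z' t.1 ω) ^ 2 ∂μ) = D at *
  obtain ⟨⟨t₀, ht₀⟩, hV1⟩ := hex
  have hD0 : 0 ≤ D :=
    le_trans (integral_nonneg fun _ => sq_nonneg _) (hD a (left_mem_Icc.2 hab.le))
  have hinc : ∀ s t, s ≤ t → s ∈ Icc a b → t ∈ Icc a b →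
      ∫ ω, (Z t ω - Z s ω) ^ 2 ∂μ ≤ (t - s) ^ 2 * D := by
    intro s t hst hs ht
    have hsub : Icc s t ⊆ Icc a b := Icc_subset_Icc hs.1 ht.2
    exact incr_le hst (fun ω u hu => hd ω u (hsub hu)) (fun ω => (hc ω).mono hsub)
      (fun u hu => hi u (hsub hu)) (fun u hu => hm u (hsub hu)) (fun u hu => hD u (hsub hu))
  have hinc2 : ∀ s t, s ≤ t → s ∈ Icc a b → t ∈ Icc a b →
      ∫ ω, (Z t ω - Z s ω) ^ 2 ∂μ ≤ S / 2 := by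
    intro s t hst hs ht
    have h1 := hinc s t hst hs ht
    have h2 : (t - s) ^ 2 * D ≤ (b - a) ^ 2 * D := by
      have h3 : t - s ≤ b - a := by linarith [hs.1, ht.2]
      have h4 : 0 ≤ t - s := by linarith
      gcongr
    linarith
  have hinc3 : ∀ s ∈ Icc a b, ∀ t ∈ Icc a b, ∫ ω, (Z t ω - Z s ω) ^ 2 ∂μ ≤ S / 2 := by
    intro s hs t ht
    rcases le_total s t with h | h
    · exact hinc2 s t h hs ht
    · have := hinc2 t s h ht hs
      simpa only [sub_sq_comm] using this
  set τ : ℕ → ℕ → ℝ := fun n k => a + k * ((b - a) / 2 ^ n) with hτ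
  have hba : 0 < b - a := sub_pos.2 hab
  have hτmem : ∀ n k, k ≤ 2 ^ n → τ n k ∈ Icc a b := by
    intro n k hk
    have hk' : (k : ℝ) ≤ 2 ^ n := by exact_mod_cast hk
    have h2 : (k : ℝ) * ((b - a) / 2 ^ n) ≤ 2 ^ n * ((b - a) / 2 ^ n) := by gcongr
    have h3 : (2 : ℝ) ^ n * ((b - a) / 2 ^ n) = b - a := by field_simp
    have h4 : 0 ≤ (k : ℝ) * ((b - a) / 2 ^ n) := by positivity
    simp only [hτ, mem_Icc]
    constructor <;> linarith
  set A : ℕ → Set Ω := fun n => {ω | ∀ k ≤ 2 ^ n, Z (τ n k) ω ≤ - 2 * √S} with hA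
  have hAc : ∀ n, (gaussianReal 0 1 (Iio (-64))).toReal / 2 ≤ (μ (A n)).toReal := by
    intro n
    refine grid_bound hZ (τ n) (2 ^ n) (by positivity) t₀ S hS hV1 (hSle t₀ ht₀) ?_ ?_
    · intro k hk
      exact hinc3 _ ht₀ _ (hτmem n k hk)
    · intro k hk
      have e : τ n (k + 1) - τ n k = (b - a) / 2 ^ n := by
        simp only [hτ]; push_cast; ring
      have e0 : 0 < (b - a) / 2 ^ n := by positivity
      have h := hinc (τ n k) (τ n (k + 1)) (by linarith) (hτmem n k hk.le) (hτmem n (k + 1) hk)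
      rw [e] at h
      refine h.trans ?_
      push_cast
      rw [div_pow, le_div_iff₀ (by positivity)]
      have : (b - a) ^ 2 / (2 ^ n) ^ 2 * D * (2 * (2 ^ n) ^ 2) = 2 * (b - a) ^ 2 * D := by
        field_simp
      rw [this]; exact hle
  have hanti : Antitone A := by
    refine antitone_nat_of_succ_le fun n ω hω k hk => ?_
    have h := hω (2 * k) (by rw [pow_succ]; omega)
    have e : τ (n + 1) (2 * k) = τ n k := by
      simp only [hτ]; push_cast; rw [pow_succ]; field_simp
    rwa [e] at h
  have hmeas : ∀ n, NullMeasurableSet (A n) μ := by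
    intro n
    have e : A n = ⋂ k : ℕ, ⋂ (_ : k ≤ 2 ^ n), {ω | Z (τ n k) ω ≤ - 2 * √S} := by
      ext ω; simp [hA]
    rw [e]
    refine NullMeasurableSet.iInter fun k => NullMeasurableSet.iInter fun _ => ?_
    exact nullMeasurableSet_le (hZ.eval _).memLp.aestronglyMeasurable.aemeasurable
      aemeasurable_const
  have hlim := tendsto_measure_iInter_atTop (μ := μ) hmeas hanti ⟨0, measure_ne_top _ _⟩
  have hlim' := (ENNReal.tendsto_toReal (measure_ne_top μ (⋂ n, A n))).comp hlim
  have hfin := ge_of_tendsto' hlim' hAc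
  refine hfin.trans (ENNReal.toReal_mono (measure_ne_top _ _) (measure_mono ?_))
  intro ω hω t ht
  rw [mem_iInter] at hω
  have hta : 0 ≤ t - a := sub_nonneg.2 ht.1
  set κ : ℕ → ℕ := fun n => ⌊(t - a) / ((b - a) / 2 ^ n)⌋₊ with hκ
  have hκle : ∀ n, κ n ≤ 2 ^ n := by
    intro n
    have : ((κ n : ℕ) : ℝ) ≤ 2 ^ n := by
      refine (Nat.floor_le (by positivity)).trans ?_
      rw [div_le_iff₀ (by positivity)]
      have h3 : (2 : ℝ) ^ n * ((b - a) / 2 ^ n) = b - a := by field_simp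
      rw [h3]; linarith [ht.2]
    exact_mod_cast this
  have hz : Tendsto (fun n : ℕ => (b - a) / (2 : ℝ) ^ n) atTop (nhds 0) :=
    tendsto_const_nhds.div_atTop (tendsto_pow_atTop_atTop_of_one_lt one_lt_two)
  have htend : Tendsto (fun n => τ n (κ n)) atTop (nhds t) := by
    have hlo : Tendsto (fun n : ℕ => t - (b - a) / (2 : ℝ) ^ n) atTop (nhds t) := by
      simpa using tendsto_const_nhds.sub hz
    refine tendsto_of_tendsto_of_tendsto_of_le_of_le hlo tendsto_const_nhds ?_ ?_
    · intro n
      have hp : 0 < (b - a) / (2 : ℝ) ^ n := by positivity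
      have h := Nat.lt_floor_add_one ((t - a) / ((b - a) / 2 ^ n))
      rw [div_lt_iff₀ hp] at h
      simp only [hτ, hκ]
      linarith
    · intro n
      have hp : 0 < (b - a) / (2 : ℝ) ^ n := by positivity
      have h := Nat.floor_le (a := (t - a) / ((b - a) / 2 ^ n)) (by positivity)
      rw [le_div_iff₀ hp] at h
      simp only [hτ, hκ]
      linarith
  have hcont := (hd ω t ht).continuousAt.tendsto.comp htend
  have hfinal : Z t ω ≤ - 2 * √S := le_of_tendsto' hcont fun n => hω n (κ n) (hκle n)
  have : 0 < √S := Real.sqrt_pos.2 hS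
  linarith
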